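/- arXiv:1309.2621 — 2 statements merged into one kernel-verified Lean document; each statement's English description precedes it below -/
import Mathlib

section
/- Fix an integer N ≥ 2 and positive reals σ_1, …, σ_N. Define c_{k,l}(σ) := tr(ρA) − 2(ρAρ)_{kl}/ρ_{kl}, where A is the (N−1)×(N−1) symmetric tridiagonal matrix with A_{ii} = σ_i² + σ_{i+1}², A_{i,i+1} = A_{i+1,i} = −σ_{i+1}², A_{ij} = 0 for |i−j| ≥ 2, and ρ is the (N−1)×(N−1) matrix with ρ_{ij} = 2·min(i,j)·(N − max(i,j))/N. For a vector α = (α_1,…,α_M) ∈ ℝ^M and l = 1,…,M−1, define c_l(α) := −(2(M−1)/M)α_1² + (2(M+1)/M)·Σ_{p=2}^{l} α_p² + ((2(M−1)(M−l) − 4l)/((M−l)M))·Σ_{p=l+1}^{M} α_p², and let α^← := (α_M, …, α_1) denote the reversed vector. Then for all k = 1, …, N−1, we have c_{k,N−1}(σ) = c_{N−k}(σ^←), where c_{N−k}(σ^←) is computed with M = N and α = (σ_N,…,σ_1). -/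
open Finset Matrix

/-- The difference matrix sending particle positions to gaps. -/
def gapMatrix (n : ℕ) : Matrix (Fin n) (Fin (n + 1)) ℝ := fun i p =>
  (if p = i.succ then 1 else 0) - (if p = i.castSucc then 1 else 0)

/-- The discrete Dirichlet Green function on `{0, …, N}`. -/
noncomputable def dirichletGreen (N : ℕ) (x y : ℕ) : ℝ :=
  2 * (min x y : ℕ) * ((N : ℝ) - (max x y : ℕ)) / N

theorem dirichletGreen_comm (N x y : ℕ) : dirichletGreen N x y = dirichletGreen N y x := by
  simp only [dirichletGreen, min_comm, max_comm]

theorem dirichletGreen_of_le {N x y : ℕ} (h : x ≤ y) :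
    dirichletGreen N x y = 2 * x * ((N : ℝ) - y) / N := by
  simp [dirichletGreen, h]

theorem dirichletGreen_of_ge {N x y : ℕ} (h : y ≤ x) :
    dirichletGreen N x y = 2 * y * ((N : ℝ) - x) / N := by
  simp [dirichletGreen, h]

theorem dirichletGreen_zero_left (N y : ℕ) : dirichletGreen N 0 y = 0 := by
  simp [dirichletGreen]

theorem dirichletGreen_self_left {N y : ℕ} (h : y ≤ N) : dirichletGreen N N y = 0 := by
  simp [dirichletGreen, h]

theorem sum_mul_gapMatrix {n : ℕ} (F : ℕ → ℝ) (h0 : F 0 = 0) (hn : F (n + 1) = 0)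
    (p : Fin (n + 1)) :
    ∑ i : Fin n, F (i.1 + 1) * gapMatrix n i p = F p.1 - F (p.1 + 1) := by
  simp only [gapMatrix, mul_sub, sum_sub_distrib, mul_ite, mul_one, mul_zero]
  congr 1
  · induction p using Fin.cases with
    | zero => simp [h0, Fin.ext_iff]
    | succ p => simp
  · induction p using Fin.lastCases with
    | last =>
      rw [Fin.val_last, hn]
      exact sum_eq_zero fun i _ => if_neg i.castSucc_lt_last.ne'
    | cast p => simp

theorem sum_gapMatrix_mul {n : ℕ} (g : Fin (n + 1) → ℝ) (i : Fin n) :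
    ∑ p, gapMatrix n i p * g p = g i.succ - g i.castSucc := by
  simp [gapMatrix, sub_mul, sum_sub_distrib]

/-- The difference in the second variable of the Green function. -/
theorem dirichletGreen_sub {N x y : ℕ} (hN : N ≠ 0) :
    dirichletGreen N x y - dirichletGreen N x (y + 1)
      = if y < x then -(2 * ((N : ℝ) - x) / N) else 2 * x / N := by
  have : (N : ℝ) ≠ 0 := by exact_mod_cast hN
  split_ifs with h
  · rw [dirichletGreen_of_ge h.le, dirichletGreen_of_ge h]
    push_cast
    field_simp
    ring
  · rw [dirichletGreen_of_le (by omega), dirichletGreen_of_le (by omega)]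
    push_cast
    field_simp
    ring

theorem dirichletGreen_mul_gapMatrix {n : ℕ} (x : ℕ) (hx : x ≤ n + 1) (p : Fin (n + 1)) :
    ∑ i : Fin n, dirichletGreen (n + 1) x (i.1 + 1) * gapMatrix n i p
      = if p.1 < x then -(2 * (((n + 1 : ℕ) : ℝ) - x) / (n + 1 : ℕ)) else 2 * x / (n + 1 : ℕ) := by
  rw [sum_mul_gapMatrix (fun y => dirichletGreen (n + 1) x y), dirichletGreen_sub (by omega)]
  · rw [dirichletGreen_comm, dirichletGreen_zero_left]
  · rw [dirichletGreen_comm, dirichletGreen_self_left hx]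

/-- The covariance matrix of the gaps factors through the difference matrix. -/
theorem gap_covariance_apply {n : ℕ} (s : Fin (n + 1) → ℝ) (i j : Fin n) :
    (gapMatrix n * diagonal s * (gapMatrix n)ᵀ) i j =
      if i = j then s i.castSucc + s i.succ
      else if i.1 + 1 = j.1 ∨ j.1 + 1 = i.1 then -s ⟨max i.1 j.1, by omega⟩
      else 0 := by
  rw [mul_apply]
  simp only [mul_diagonal, transpose_apply, mul_assoc]
  rw [sum_gapMatrix_mul (fun p => s p * gapMatrix n j p)]
  simp only [gapMatrix]
  rcases lt_trichotomy i.1 j.1 with h | h | h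
  · by_cases h' : i.1 + 1 = j.1
    · have e : (⟨max i.1 j.1, by omega⟩ : Fin (n + 1)) = i.succ := by
        ext; simp; omega
      rw [e]
      simp [Fin.ext_iff, h', h.ne, show i.1 ≠ j.1 + 1 by omega]
    · simp [Fin.ext_iff, h', h.ne, show i.1 ≠ j.1 + 1 by omega, show j.1 + 1 ≠ i.1 by omega]
  · obtain rfl := Fin.ext h
    simp [Fin.ext_iff, add_comm]
  · by_cases h' : j.1 + 1 = i.1
    · have e : (⟨max i.1 j.1, by omega⟩ : Fin (n + 1)) = i.castSucc := by
        ext; simp; omega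
      rw [e]
      simp [Fin.ext_iff, ← h', show j.1 + 1 + 1 ≠ j.1 by omega]
    · simp [Fin.ext_iff, h', h.ne', show i.1 ≠ j.1 + 1 by omega, show i.1 + 1 ≠ j.1 by omega]

theorem dirichletGreen_mul_covariance_trace {n : ℕ} (s : Fin (n + 1) → ℝ)
    {R : Matrix (Fin n) (Fin n) ℝ}
    (hR : ∀ i j, R i j = dirichletGreen (n + 1) (i.1 + 1) (j.1 + 1)) :
    trace (R * (gapMatrix n * diagonal s * (gapMatrix n)ᵀ))
      = ∑ p, 2 * (((n + 1 : ℕ) : ℝ) - 1) / (n + 1 : ℕ) * s p := by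
  rw [← Matrix.mul_assoc, ← Matrix.mul_assoc, trace_mul_comm, ← Matrix.mul_assoc, trace]
  refine sum_congr rfl fun p _ => ?_
  have hE : ∀ i, (R * gapMatrix n) i p = dirichletGreen (n + 1) (i.1 + 1) p.1
      - dirichletGreen (n + 1) (i.1 + 1) (p.1 + 1) := fun i => by
    rw [mul_apply, dirichletGreen_sub (by omega), ← dirichletGreen_mul_gapMatrix _ (by omega)]
    simp only [hR]
  rw [diag_apply, mul_diagonal, mul_apply]
  congr 1
  simp only [transpose_apply, hE, mul_comm (gapMatrix n _ p)]
  rw [sum_mul_gapMatrix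
    (fun x => dirichletGreen (n + 1) x p.1 - dirichletGreen (n + 1) x (p.1 + 1))]
  · have : ((n + 1 : ℕ) : ℝ) ≠ 0 := by positivity
    rw [dirichletGreen_sub (by omega), dirichletGreen_sub (by omega), if_neg (lt_irrefl _),
      if_pos (Nat.lt_succ_self _)]
    push_cast at this ⊢
    field_simp
    ring
  · simp only [dirichletGreen_zero_left, sub_zero]
  · rw [dirichletGreen_self_left (by omega), dirichletGreen_self_left (by omega), sub_zero]

theorem dirichletGreen_covariance_sandwich {n : ℕ} (s : Fin (n + 1) → ℝ)
    {R : Matrix (Fin n) (Fin n) ℝ}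
    (hR : ∀ i j, R i j = dirichletGreen (n + 1) (i.1 + 1) (j.1 + 1)) (k l : Fin n) :
    (R * (gapMatrix n * diagonal s * (gapMatrix n)ᵀ) * R) k l
      = ∑ p : Fin (n + 1),
        (if p.1 < k.1 + 1 then -(2 * (((n + 1 : ℕ) : ℝ) - (k.1 + 1 : ℕ)) / (n + 1 : ℕ))
          else 2 * (k.1 + 1 : ℕ) / (n + 1 : ℕ)) * s p *
        (if p.1 < l.1 + 1 then -(2 * (((n + 1 : ℕ) : ℝ) - (l.1 + 1 : ℕ)) / (n + 1 : ℕ))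
          else 2 * (l.1 + 1 : ℕ) / (n + 1 : ℕ)) := by
  have hE : ∀ i p, (R * gapMatrix n) i p
      = ∑ j : Fin n, dirichletGreen (n + 1) (i.1 + 1) (j.1 + 1) * gapMatrix n j p := fun i p => by
    simp only [mul_apply, hR]
  have hT : Rᵀ = R := by
    ext i j
    rw [transpose_apply, hR, hR, dirichletGreen_comm]
  have : R * (gapMatrix n * diagonal s * (gapMatrix n)ᵀ) * R
      = (R * gapMatrix n) * diagonal s * (R * gapMatrix n)ᵀ := by
    rw [transpose_mul, hT]
    simp only [Matrix.mul_assoc]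
  rw [this, mul_apply]
  refine sum_congr rfl fun p _ => ?_
  rw [mul_diagonal, transpose_apply, hE, hE, dirichletGreen_mul_gapMatrix _ (by omega),
    dirichletGreen_mul_gapMatrix _ (by omega)]

/-- Last-column case: `c_{k,N−1}(σ) = c_{N−k}(σ^←)`, where
`c_{k,l}(σ) := tr(ρA) − 2 (ρAρ)_{kl} / ρ_{kl}`, `c_l(α)` is as in the paper (with `M = N`)
and `σ^←` is the reversed vector `(σ_N, …, σ_1)`. -/
theorem ckl_last_column (N : ℕ) (hN : 2 ≤ N) (σ : Fin N → ℝ) (hσ : ∀ i, 0 < σ i) :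
    let A : Matrix (Fin (N - 1)) (Fin (N - 1)) ℝ := fun i j =>
      if i = j then
        σ ⟨i.1, by have := i.isLt; omega⟩ ^ 2 + σ ⟨i.1 + 1, by have := i.isLt; omega⟩ ^ 2
      else if i.1 + 1 = j.1 ∨ j.1 + 1 = i.1 then
        -σ ⟨max i.1 j.1, by have := i.isLt; have := j.isLt; omega⟩ ^ 2
      else 0
    let ρ : Matrix (Fin (N - 1)) (Fin (N - 1)) ℝ := fun i j =>
      2 * (min (i.1 + 1) (j.1 + 1) : ℕ) * ((N : ℝ) - (max (i.1 + 1) (j.1 + 1) : ℕ)) / N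
    -- `c α l` is the quantity `c_l(α)` of the paper, with `M = N` (indices 1-based)
    let c : (Fin N → ℝ) → Fin (N - 1) → ℝ := fun α l =>
      -(2 * ((N : ℝ) - 1) / N) * α ⟨0, by omega⟩ ^ 2
        + 2 * ((N : ℝ) + 1) / N *
          (∑ p ∈ Finset.univ.filter fun p : Fin N => 1 ≤ p.1 ∧ p.1 ≤ l.1, α p ^ 2)
        + (2 * ((N : ℝ) - 1) * ((N : ℝ) - ((l.1 : ℝ) + 1)) - 4 * ((l.1 : ℝ) + 1)) /
          (((N : ℝ) - ((l.1 : ℝ) + 1)) * N) *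
          (∑ p ∈ Finset.univ.filter fun p : Fin N => l.1 < p.1, α p ^ 2)
    -- the reversed vector `σ^← = (σ_N, …, σ_1)`
    let σrev : Fin N → ℝ := fun p => σ p.rev
    ∀ k : Fin (N - 1),
      Matrix.trace (ρ * A) - 2 * (ρ * A * ρ) k ⟨N - 2, by omega⟩ / ρ k ⟨N - 2, by omega⟩
        = c σrev ⟨N - k.1 - 2, by omega⟩ := by
  obtain ⟨n, rfl⟩ : ∃ n, N = n + 1 := ⟨N - 1, by omega⟩
  intro A ρ c σrev k
  change Fin n at k
  have hA : A = gapMatrix n * diagonal (fun p => σ p ^ 2) * (gapMatrix n)ᵀ := by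
    ext i j
    exact (gap_covariance_apply (fun p => σ p ^ 2) i j).symm
  have hρ : ∀ i j : Fin n, ρ i j = dirichletGreen (n + 1) (i.1 + 1) (j.1 + 1) := fun _ _ => rfl
  have hk := k.isLt
  have hc : ∀ l : Fin n, c σrev l = ∑ p : Fin (n + 1),
      (if p.1 = n then -(2 * (((n + 1 : ℕ) : ℝ) - 1) / (n + 1 : ℕ))
        else if n - l.1 ≤ p.1 then 2 * (((n + 1 : ℕ) : ℝ) + 1) / (n + 1 : ℕ)
        else (2 * (((n + 1 : ℕ) : ℝ) - 1) * (((n + 1 : ℕ) : ℝ) - ((l.1 : ℝ) + 1))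
          - 4 * ((l.1 : ℝ) + 1)) / ((((n + 1 : ℕ) : ℝ) - ((l.1 : ℝ) + 1)) * (n + 1 : ℕ)))
        * σ p ^ 2 := fun l => by
    have h0 : σrev ⟨0, by omega⟩ ^ 2 = ∑ p : Fin (n + 1), if p.1 = 0 then σrev p ^ 2 else 0 := by
      rw [sum_eq_single (⟨0, by omega⟩ : Fin (n + 1))]
      · simp
      · intro p _ hp
        exact if_neg fun h => hp (Fin.ext h)
      · simp
    simp only [c]
    rw [h0, sum_filter, sum_filter, mul_sum, mul_sum, mul_sum, ← sum_add_distrib,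
      ← sum_add_distrib, ← Equiv.sum_comp Fin.revPerm]
    refine sum_congr rfl fun p _ => ?_
    have hp := p.isLt
    have hl := l.isLt
    simp only [σrev, Fin.revPerm_apply, Fin.rev_rev, Fin.val_rev]
    by_cases h1 : p.1 = n
    · simp [h1]
    · by_cases h2 : n - l.1 ≤ p.1
      · rw [if_neg h1, if_pos h2, if_neg (by omega), if_pos (by omega), if_neg (by omega)]
        ring
      · rw [if_neg h1, if_neg h2, if_neg (by omega), if_neg (by omega), if_pos (by omega)]
        ring
  have hcast : ((n + 1 - k.1 - 2 : ℕ) : ℝ) = n - k.1 - 1 := by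
    rw [show n + 1 - k.1 - 2 = n - (k.1 + 1) by omega, Nat.cast_sub (by omega)]
    push_cast
    ring
  have hlast : ((n - 1 : ℕ) : ℝ) = n - 1 := by
    rw [Nat.cast_sub (by omega), Nat.cast_one]
  rw [hA, dirichletGreen_mul_covariance_trace _ hρ, dirichletGreen_covariance_sandwich _ hρ, hc,
    hρ, dirichletGreen_of_le (show k.1 + 1 ≤ n + 1 - 2 + 1 by omega), mul_sum, sum_div,
    ← sum_sub_distrib]
  refine sum_congr rfl fun p _ => ?_
  have hp := p.isLt
  have hn0 : (n : ℝ) + 1 ≠ 0 := by positivity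
  have hk0 : (k.1 : ℝ) + 1 ≠ 0 := by positivity
  have hone : (n : ℝ) + 1 - (n - 1 + 1) = 1 := by ring
  have hden : (n : ℝ) + 1 - (n - k.1 - 1 + 1) = k.1 + 1 := by ring
  dsimp only
  by_cases h1 : p.1 = n
  · rw [if_neg (by omega), if_neg (by omega), if_pos h1]
    push_cast [hlast]
    rw [hone]
    field_simp
    ring
  · by_cases h2 : p.1 < k.1 + 1
    · rw [if_pos h2, if_pos (by omega), if_neg h1, if_neg (by omega)]
      push_cast [hlast, hcast]
      rw [hone, hden]
      field_simp
      ring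
    · rw [if_neg h2, if_pos (by omega), if_neg h1, if_pos (by omega)]
      push_cast [hlast]
      rw [hone]
      field_simp
      ring
end

section
/- Let σ_1, σ_2, σ_3, σ_4 be positive reals, let λ := (σ_1² + σ_2² + σ_3² + σ_4²)/(σ_2² + σ_3²), and let Q be the 3×3 matrix [[1, 1, 1], [1, λ, 1], [1, 1, 1]]. Let A be the 3×3 matrix [[σ_1² + σ_2², −σ_2², 0], [−σ_2², σ_2² + σ_3², −σ_3²], [0, −σ_3², σ_3² + σ_4²]]. Then QAQ = (tr(QA)/2)·Q. -/
/-- For the matrix `Q` chosen in the proof of Theorem 2.2 (with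
`λ = (σ₁² + σ₂² + σ₃² + σ₄²)/(σ₂² + σ₃²)`) and the covariance matrix `A` of the gap
process of four competing Brownian particles, `QAQ = (tr(QA)/2) Q`. -/
theorem QAQ_eq_half_trace_smul_Q (σ1 σ2 σ3 σ4 : ℝ)
    (h1 : 0 < σ1) (h2 : 0 < σ2) (h3 : 0 < σ3) (h4 : 0 < σ4) :
    let lam : ℝ := (σ1 ^ 2 + σ2 ^ 2 + σ3 ^ 2 + σ4 ^ 2) / (σ2 ^ 2 + σ3 ^ 2)
    let Q : Matrix (Fin 3) (Fin 3) ℝ := !![1, 1, 1; 1, lam, 1; 1, 1, 1]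
    let A : Matrix (Fin 3) (Fin 3) ℝ :=
      !![σ1 ^ 2 + σ2 ^ 2, -σ2 ^ 2, 0;
         -σ2 ^ 2, σ2 ^ 2 + σ3 ^ 2, -σ3 ^ 2;
         0, -σ3 ^ 2, σ3 ^ 2 + σ4 ^ 2]
    Q * A * Q = (Matrix.trace (Q * A) / 2) • Q := by
  have hne : σ2 ^ 2 + σ3 ^ 2 ≠ 0 := by positivity
  intro lam Q A
  ext i j
  fin_cases i <;> fin_cases j <;>
    simp [Q, A, lam, Matrix.mul_apply, Matrix.trace, Fin.sum_univ_three] <;>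
    field_simp <;> ring
end
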